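/- (Algebraic core of Lemma 3.1 (ii).) Let ν ∈ ℝ³ be a unit vector, let η, τ ∈ ℝ with η² − τ² = −4, and let M = (i/2)(α·ν)(η I₄ + τ β). Then for all vectors u₊, u₋ ∈ ℂ⁴, the transmission condition i(α·ν)(u₊ − u₋) + (1/2)(η I₄ + τ β)(u₊ + u₋) = 0 holds if and only if (I₄ − M) u₊ = 0 and (I₄ + M) u₋ = 0. -/

import Mathlib

open Matrix

/-- The Pauli matrices σ₁, σ₂, σ₃. -/
noncomputable def pauli : Fin 3 → Matrix (Fin 2) (Fin 2) ℂ :=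
  ![!![0, 1; 1, 0], !![0, -Complex.I; Complex.I, 0], !![1, 0; 0, -1]]

/-- The Dirac matrices α₁, α₂, α₃, in 2×2 block form αₖ = [[0, σₖ], [σₖ, 0]]. -/
noncomputable def diracAlpha (k : Fin 3) : Matrix (Fin 4) (Fin 4) ℂ :=
  Matrix.reindex finSumFinEquiv finSumFinEquiv
    (Matrix.fromBlocks 0 (pauli k) (pauli k) 0)

/-- The Dirac matrix β = [[I₂, 0], [0, -I₂]]. -/
noncomputable def diracBeta : Matrix (Fin 4) (Fin 4) ℂ :=
  Matrix.reindex finSumFinEquiv finSumFinEquiv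
    (Matrix.fromBlocks (1 : Matrix (Fin 2) (Fin 2) ℂ) (0 : Matrix (Fin 2) (Fin 2) ℂ) (0 : Matrix (Fin 2) (Fin 2) ℂ) (-1 : Matrix (Fin 2) (Fin 2) ℂ))

/-- For ν ∈ ℝ³, the matrix α·ν = ν₁α₁ + ν₂α₂ + ν₃α₃. -/
noncomputable def alphaDot (ν : Fin 3 → ℝ) : Matrix (Fin 4) (Fin 4) ℂ :=
  (ν 0 : ℂ) • diracAlpha 0 + (ν 1 : ℂ) • diracAlpha 1 + (ν 2 : ℂ) • diracAlpha 2

/-- The matrix σ·ν = ν₁σ₁ + ν₂σ₂ + ν₃σ₃. -/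
noncomputable def pauliDot (ν : Fin 3 → ℝ) : Matrix (Fin 2) (Fin 2) ℂ :=
  (ν 0 : ℂ) • pauli 0 + (ν 1 : ℂ) • pauli 1 + (ν 2 : ℂ) • pauli 2

theorem pauliDot_mul_self (ν : Fin 3 → ℝ) :
    pauliDot ν * pauliDot ν = ((ν 0 ^ 2 + ν 1 ^ 2 + ν 2 ^ 2 : ℝ) : ℂ) • 1 := by
  ext i j
  fin_cases i <;> fin_cases j <;>
    simp [pauliDot, pauli, Matrix.mul_apply, Fin.sum_univ_two] <;>
    ring_nf <;> simp [Complex.I_sq]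

theorem alphaDot_eq_reindex (ν : Fin 3 → ℝ) :
    alphaDot ν = Matrix.reindex finSumFinEquiv finSumFinEquiv
      (Matrix.fromBlocks 0 (pauliDot ν) (pauliDot ν) 0) := by
  have h : Matrix.fromBlocks 0 (pauliDot ν) (pauliDot ν) 0 =
      (ν 0 : ℂ) • Matrix.fromBlocks 0 (pauli 0) (pauli 0) 0
        + (ν 1 : ℂ) • Matrix.fromBlocks 0 (pauli 1) (pauli 1) 0
        + (ν 2 : ℂ) • Matrix.fromBlocks 0 (pauli 2) (pauli 2) 0 := by
    simp [pauliDot, Matrix.fromBlocks_smul, Matrix.fromBlocks_add]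
  rw [h]
  rfl

theorem alphaDot_mul_self (ν : Fin 3 → ℝ) :
    alphaDot ν * alphaDot ν = ((ν 0 ^ 2 + ν 1 ^ 2 + ν 2 ^ 2 : ℝ) : ℂ) • 1 := by
  rw [alphaDot_eq_reindex, Matrix.reindex_apply, Matrix.submatrix_mul_equiv,
    Matrix.fromBlocks_multiply]
  simp only [pauliDot_mul_self, zero_mul, mul_zero, add_zero, zero_add]
  have h (c : ℂ) : Matrix.fromBlocks (c • (1 : Matrix (Fin 2) (Fin 2) ℂ)) 0 0
      (c • (1 : Matrix (Fin 2) (Fin 2) ℂ)) = c • 1 := by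
    rw [← Matrix.fromBlocks_one, Matrix.fromBlocks_smul, smul_zero]
  rw [h, Matrix.submatrix_smul, Pi.smul_apply, Pi.smul_apply, Matrix.submatrix_one_equiv]

theorem diracBeta_mul_self : diracBeta * diracBeta = 1 := by
  simp [diracBeta, Matrix.submatrix_mul_equiv, Matrix.fromBlocks_multiply]

theorem diracBeta_mul_alphaDot (ν : Fin 3 → ℝ) :
    diracBeta * alphaDot ν = -(alphaDot ν * diracBeta) := by
  rw [alphaDot_eq_reindex, diracBeta, Matrix.reindex_apply, Matrix.reindex_apply,
    Matrix.submatrix_mul_equiv, Matrix.submatrix_mul_equiv]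
  have h : Matrix.fromBlocks 1 0 0 (-1) * Matrix.fromBlocks 0 (pauliDot ν) (pauliDot ν) 0 =
      -(Matrix.fromBlocks 0 (pauliDot ν) (pauliDot ν) 0 * Matrix.fromBlocks 1 0 0 (-1)) := by
    simp [Matrix.fromBlocks_multiply, Matrix.fromBlocks_neg]
  rw [h]
  rfl

/-- The ranges of the complementary projections `(1 ∓ M) / 2` of an involution `M` meet only
in zero. -/
theorem mulVec_one_sub_sub_mulVec_one_add_eq_zero_iff {n : Type*} [Fintype n] [DecidableEq n]
    {M : Matrix n n ℂ} (hM : M * M = 1) (u v : n → ℂ) :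
    (1 - M).mulVec u - (1 + M).mulVec v = 0 ↔
      (1 - M).mulVec u = 0 ∧ (1 + M).mulVec v = 0 := by
  refine ⟨fun h => ?_, fun ⟨hu, hv⟩ => by rw [hu, hv, sub_zero]⟩
  have hadd : (1 + M) * (1 - M) = 0 := by noncomm_ring; simp [hM]
  have hsq : (1 + M) * (1 + M) = (2 : ℂ) • (1 + M) := by
    rw [mul_add, add_mul, add_mul, hM, two_smul]; simp only [one_mul, mul_one]; abel
  have hv : (1 + M).mulVec v = 0 := by
    have := congrArg (1 + M).mulVec h
    rw [Matrix.mulVec_sub, Matrix.mulVec_mulVec, Matrix.mulVec_mulVec, hadd, hsq,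
      Matrix.zero_mulVec, Matrix.mulVec_zero, zero_sub, neg_eq_zero, Matrix.smul_mulVec] at this
    exact (smul_eq_zero.mp this).resolve_left two_ne_zero
  exact ⟨by rwa [hv, sub_zero] at h, hv⟩

/-- Algebraic core of Lemma 3.1 (ii): if η² − τ² = −4 then the transmission condition
i(α·ν)(uPlus − uMinus) + (1/2)(η I₄ + τβ)(uPlus + uMinus) = 0 holds iff
(I₄ − M) uPlus = 0 and (I₄ + M) uMinus = 0, with M = (i/2)(α·ν)(η I₄ + τβ). -/
theorem transmission_condition_confinement (ν : Fin 3 → ℝ)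
    (hν : ν 0 ^ 2 + ν 1 ^ 2 + ν 2 ^ 2 = 1)
    (η τ : ℝ) (hconf : η ^ 2 - τ ^ 2 = -4)
    (M : Matrix (Fin 4) (Fin 4) ℂ)
    (hM : M = (Complex.I / 2) • (alphaDot ν * ((η : ℂ) • 1 + (τ : ℂ) • diracBeta))) :
    ∀ uPlus uMinus : Fin 4 → ℂ,
      (Complex.I • alphaDot ν).mulVec (uPlus - uMinus)
          + (((1 : ℂ) / 2) • ((η : ℂ) • 1 + (τ : ℂ) • diracBeta)).mulVec (uPlus + uMinus) = 0
        ↔ (1 - M).mulVec uPlus = 0 ∧ (1 + M).mulVec uMinus = 0 := by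
  intro u v
  have hA : alphaDot ν * alphaDot ν = 1 := by rw [alphaDot_mul_self, hν]; simp
  have hβA := diracBeta_mul_alphaDot ν
  have hconf' : (τ : ℂ) ^ 2 = η ^ 2 + 4 := by
    have : τ ^ 2 = η ^ 2 + 4 := by linarith
    exact_mod_cast this
  set A := alphaDot ν
  set B : Matrix (Fin 4) (Fin 4) ℂ := (η : ℂ) • 1 + (τ : ℂ) • diracBeta with hB
  have hBA : B * A = A * ((η : ℂ) • 1 - (τ : ℂ) • diracBeta) := by
    simp only [hB, add_mul, mul_sub, smul_mul_assoc, mul_smul_comm, one_mul, mul_one, hβA,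
      smul_neg]
    abel
  have hBB : ((η : ℂ) • 1 - (τ : ℂ) • diracBeta) * B = (-4 : ℂ) • 1 := by
    simp only [hB, sub_mul, mul_add, smul_mul_assoc, mul_smul_comm, one_mul, mul_one,
      diracBeta_mul_self]
    rw [smul_sub, smul_sub, smul_comm (η : ℂ) (τ : ℂ) diracBeta]
    have : (-4 : ℂ) = η * η - τ * τ := by linear_combination hconf'
    rw [this, sub_smul, mul_smul, mul_smul]
    abel
  have hMM : M * M = 1 := by
    rw [hM, smul_mul_smul_comm, mul_assoc, ← mul_assoc B, hBA, mul_assoc A, hBB,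
      ← mul_assoc, hA, one_mul, smul_smul]
    have : Complex.I / 2 * (Complex.I / 2) * -4 = 1 := by
      linear_combination -Complex.I_mul_I
    rw [this, one_smul]
  have hAM : (Complex.I • A) * M = -(((1 : ℂ) / 2) • B) := by
    rw [hM, smul_mul_smul_comm, ← mul_assoc, hA, one_mul, ← neg_smul]
    congr 1
    linear_combination (1 / 2 : ℂ) * Complex.I_mul_I
  have hfactor : (Complex.I • A).mulVec (u - v) + (((1 : ℂ) / 2) • B).mulVec (u + v) =
      (Complex.I • A).mulVec ((1 - M).mulVec u - (1 + M).mulVec v) := by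
    rw [Matrix.mulVec_sub _ ((1 - M).mulVec u), Matrix.mulVec_mulVec, Matrix.mulVec_mulVec,
      mul_sub, mul_add, hAM, mul_one, Matrix.sub_mulVec, Matrix.add_mulVec, Matrix.neg_mulVec,
      Matrix.neg_mulVec, Matrix.mulVec_sub, Matrix.mulVec_add]
    abel
  have hinv : (-Complex.I • A) * (Complex.I • A) = 1 := by
    rw [smul_mul_smul_comm, hA, neg_mul, Complex.I_mul_I, neg_neg, one_smul]
  rw [hfactor, ← mulVec_one_sub_sub_mulVec_one_add_eq_zero_iff hMM]
  refine ⟨fun h => ?_, fun h => by rw [h, Matrix.mulVec_zero]⟩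
  have := congrArg (-Complex.I • A).mulVec h
  rwa [Matrix.mulVec_mulVec, hinv, Matrix.one_mulVec, Matrix.mulVec_zero] at this
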